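/- arXiv:2505.20898 — 2 statements merged into one kernel-verified Lean document; each statement's English description precedes it below -/
import Mathlib

section
/- Let G be a simple graph with N ≥ 2 vertices, E edges and T triangles. If 4E > N^2 then T ≥ E(4E − N^2)/(3N). -/
namespace SimpleGraph

variable {V : Type*} [Fintype V] (G : SimpleGraph V) [DecidableRel G.Adj]

/-- Each triangle arises from at most six ordered triples of pairwise adjacent vertices. -/
lemma sum_card_commonNeighbors_le_six_mul_card_cliqueFinset [DecidableEq V] :
    ∑ x, ∑ y ∈ G.neighborFinset x, (G.neighborFinset x ∩ G.neighborFinset y).card ≤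
      6 * (G.cliqueFinset 3).card := by
  simp_rw [← Finset.card_sigma]
  refine Finset.card_le_mul_card_image_of_maps_to
    (f := fun p : (_ : V) × (_ : V) × V => ({p.1, p.2.1, p.2.2} : Finset V)) ?_ 6 ?_
  · rintro ⟨x, y, z⟩ hp
    simp only [Finset.mem_sigma, Finset.mem_univ, true_and, Finset.mem_inter,
      mem_neighborFinset] at hp
    rw [mem_cliqueFinset_iff, is3Clique_triple_iff]
    exact ⟨hp.1, hp.2.1, hp.2.2⟩
  · intro s hs
    obtain ⟨a, b, c, -, -, -, rfl⟩ := is3Clique_iff.1 (mem_cliqueFinset_iff.1 hs)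
    refine (Finset.card_le_card (t := {⟨a, b, c⟩, ⟨a, c, b⟩, ⟨b, a, c⟩, ⟨b, c, a⟩, ⟨c, a, b⟩,
      ⟨c, b, a⟩}) ?_).trans Finset.card_le_six
    rintro ⟨x, y, z⟩ hp
    simp only [Finset.mem_filter, Finset.mem_sigma, Finset.mem_univ, true_and, Finset.mem_inter,
      mem_neighborFinset] at hp
    obtain ⟨⟨hxy, hxz, hyz⟩, hs⟩ := hp
    have hx : x ∈ ({a, b, c} : Finset V) := by simp [← hs]
    have hy : y ∈ ({a, b, c} : Finset V) := by simp [← hs]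
    have hz : z ∈ ({a, b, c} : Finset V) := by simp [← hs]
    have := hxy.ne
    have := hxz.ne
    have := hyz.ne
    simp only [Finset.mem_insert, Finset.mem_singleton] at hx hy hz
    rcases hx with rfl | rfl | rfl <;> rcases hy with rfl | rfl | rfl <;>
      rcases hz with rfl | rfl | rfl <;> simp_all

lemma sum_sum_neighborFinset_degree :
    ∑ x, ∑ y ∈ G.neighborFinset x, G.degree y = ∑ x, G.degree x ^ 2 := by
  rw [Finset.sum_comm' (t' := Finset.univ) (s' := fun y => G.neighborFinset y)
    (by simp [G.adj_comm])]
  simp [sq]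

lemma two_mul_sum_degree_sq_le [DecidableEq V] :
    2 * ∑ x, G.degree x ^ 2 ≤
      2 * G.edgeFinset.card * Fintype.card V + 6 * (G.cliqueFinset 3).card := by
  calc 2 * ∑ x, G.degree x ^ 2
      = ∑ x, ∑ y ∈ G.neighborFinset x, (G.degree x + G.degree y) := by
        simp_rw [Finset.sum_add_distrib]
        rw [sum_sum_neighborFinset_degree]
        simp [sq, two_mul]
    _ ≤ ∑ x, ∑ y ∈ G.neighborFinset x,
          (Fintype.card V + (G.neighborFinset x ∩ G.neighborFinset y).card) := by
        refine Finset.sum_le_sum fun x _ => Finset.sum_le_sum fun y _ => ?_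
        rw [← card_neighborFinset_eq_degree, ← card_neighborFinset_eq_degree,
          ← Finset.card_union_add_card_inter]
        gcongr
        exact Finset.card_le_univ _
    _ ≤ _ := by
        simp_rw [Finset.sum_add_distrib]
        gcongr
        · simp [← Finset.sum_mul, G.sum_degrees_eq_twice_card_edges]
        · exact G.sum_card_commonNeighbors_le_six_mul_card_cliqueFinset

end SimpleGraph

theorem triangle_lower_bound {V : Type*} [Fintype V] [DecidableEq V]
    (G : SimpleGraph V) [DecidableRel G.Adj]
    (hN : 2 ≤ Fintype.card V)
    (h : 4 * G.edgeFinset.card > (Fintype.card V) ^ 2) :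
    ((G.cliqueFinset 3).card : ℚ) ≥
      (G.edgeFinset.card : ℚ) *
        (4 * (G.edgeFinset.card : ℚ) - (Fintype.card V : ℚ) ^ 2) /
          (3 * (Fintype.card V : ℚ)) := by
  have hpos : (0 : ℚ) < Fintype.card V := by exact_mod_cast (by omega : 0 < Fintype.card V)
  have hcauchy : (2 * G.edgeFinset.card) ^ 2 ≤ Fintype.card V * ∑ x, G.degree x ^ 2 := by
    rw [← G.sum_degrees_eq_twice_card_edges]
    exact sq_sum_le_card_mul_sum_sq
  have hcount := Nat.mul_le_mul_left (Fintype.card V) G.two_mul_sum_degree_sq_le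
  have key : (2 * G.edgeFinset.card) ^ 2 * 2 ≤ Fintype.card V *
      (2 * G.edgeFinset.card * Fintype.card V + 6 * (G.cliqueFinset 3).card) := by linarith
  rw [ge_iff_le, div_le_iff₀ (by positivity)]
  have key' : ((2 * G.edgeFinset.card) ^ 2 * 2 : ℚ) ≤ Fintype.card V *
      (2 * G.edgeFinset.card * Fintype.card V + 6 * (G.cliqueFinset 3).card) := by
    exact_mod_cast key
  linarith
end

section
/- Let G be a simple graph with vertex degrees d_1, …, d_N and E edges, and let T be the number of triangles of G. Then 3NT ≥ 4E^2 − N^2·E. -/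
namespace SimpleGraph

variable {V : Type*} [Fintype V] [DecidableEq V] (G : SimpleGraph V) [DecidableRel G.Adj]

/-- Each triangle is the vertex set of at most six ordered triples. -/
lemma card_ordered_triangles_le :
    (Finset.univ.filter fun p : V × V × V ↦
      G.Adj p.1 p.2.1 ∧ G.Adj p.1 p.2.2 ∧ G.Adj p.2.1 p.2.2).card ≤
      6 * (G.cliqueFinset 3).card := by
  refine Finset.card_le_mul_card_image_of_maps_to
    (f := fun p : V × V × V ↦ ({p.1, p.2.1, p.2.2} : Finset V)) ?_ 6 ?_
  · rintro ⟨x, y, z⟩ h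
    simpa [mem_cliqueFinset_iff, is3Clique_triple_iff] using h
  · intro s hs
    obtain ⟨a, b, c, -, -, -, rfl⟩ := is3Clique_iff.1 (mem_cliqueFinset_iff.1 hs)
    refine (Finset.card_le_card (t := {(a, b, c), (a, c, b), (b, a, c), (b, c, a),
      (c, a, b), (c, b, a)}) ?_).trans Finset.card_le_six
    rintro ⟨x, y, z⟩ h
    simp only [Finset.mem_filter, Finset.mem_univ, true_and] at h
    obtain ⟨⟨hxy, hxz, hyz⟩, h⟩ := h
    have hx : x ∈ ({a, b, c} : Finset V) := h ▸ by simp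
    have hy : y ∈ ({a, b, c} : Finset V) := h ▸ by simp
    have hz : z ∈ ({a, b, c} : Finset V) := h ▸ by simp
    have := hxy.ne
    have := hxz.ne
    have := hyz.ne
    simp only [Finset.mem_insert, Finset.mem_singleton, Prod.mk.injEq] at hx hy hz ⊢
    grind

/-- Every edge `xy` lies in at least `d x + d y - N` triangles; summed over ordered edges. -/
lemma two_mul_sum_degree_sq_sub_le :
    2 * ∑ x, (G.degree x : ℤ) ^ 2 - Fintype.card V * ∑ x, (G.degree x : ℤ) ≤
      6 * (G.cliqueFinset 3).card := by
  let a : V → V → ℤ := fun x y ↦ if G.Adj x y then 1 else 0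
  have symm (x y : V) : a x y = a y x := by simp [a, G.adj_comm]
  have row (x : V) : ∑ y, a x y = G.degree x := by
    rw [Finset.sum_boole, ← card_neighborFinset_eq_degree, neighborFinset_eq_filter]
  have left : ∑ x, ∑ y, ∑ z, a x y * a x z = ∑ x, (G.degree x : ℤ) ^ 2 := by
    simp_rw [← Finset.mul_sum, row, ← Finset.sum_mul, row, sq]
  have right : ∑ x, ∑ y, ∑ z, a x y * a y z = ∑ x, (G.degree x : ℤ) ^ 2 := by
    rw [Finset.sum_comm, ← left]
    simp_rw [symm]
  have const : ∑ x, ∑ y, ∑ _z : V, a x y = Fintype.card V * ∑ x, (G.degree x : ℤ) := by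
    simp_rw [Finset.sum_const, Finset.card_univ, nsmul_eq_mul, ← Finset.mul_sum, row]
  have count := G.card_ordered_triangles_le
  rw [Finset.card_filter] at count
  simp only [Fintype.sum_prod_type] at count
  calc
    _ = ∑ x, ∑ y, ∑ z, (a x y * a x z + a x y * a y z - a x y) := by
      simp only [Finset.sum_sub_distrib, Finset.sum_add_distrib, left, right, const]
      ring
    _ ≤ ∑ x, ∑ y, ∑ z, (if G.Adj x y ∧ G.Adj x z ∧ G.Adj y z then 1 else 0 : ℤ) := by
      gcongr with x _ y _ z _
      by_cases hxy : G.Adj x y <;> by_cases hxz : G.Adj x z <;> by_cases hyz : G.Adj y z <;>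
        simp [a, hxy, hxz, hyz]
    _ ≤ _ := mod_cast count

end SimpleGraph

theorem three_N_T_ge {V : Type*} [Fintype V] [DecidableEq V]
    (G : SimpleGraph V) [DecidableRel G.Adj] :
    (3 : ℤ) * (Fintype.card V) * ((G.cliqueFinset 3).card) ≥
      4 * (G.edgeFinset.card : ℤ) ^ 2 - (Fintype.card V : ℤ) ^ 2 * (G.edgeFinset.card : ℤ) := by
  have triangles := mul_le_mul_of_nonneg_left G.two_mul_sum_degree_sq_sub_le
    (Nat.cast_nonneg (α := ℤ) (Fintype.card V))
  have cauchy := sq_sum_le_card_mul_sum_sq (s := Finset.univ) (f := fun x ↦ (G.degree x : ℤ))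
  have handshake : ∑ x, (G.degree x : ℤ) = 2 * G.edgeFinset.card :=
    mod_cast G.sum_degrees_eq_twice_card_edges
  rw [handshake] at triangles cauchy
  rw [Finset.card_univ] at cauchy
  linarith
end
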